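/- Every topologically transitive cellular automaton on an alphabet with at least two elements is sensitive to initial conditions. Precisely: let S be a finite alphabet with |S| ≥ 2 and let f : S^ℤ → S^ℤ be a cellular automaton that is topologically transitive. Then there exists ε > 0 such that for every x ∈ S^ℤ and every δ > 0 there exist y ∈ S^ℤ and n ∈ ℕ with d(x,y) < δ and d(f^n(x), f^n(y)) ≥ ε. -/

import Mathlib

/-- The left shift map on two-sided configurations. -/
def shiftZ {S : Type*} (x : ℤ → S) : ℤ → S := fun n => x (n + 1)

/-- A cellular automaton: a continuous map commuting with the shift. -/
def IsCellularAutomaton {S : Type*} [TopologicalSpace S]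
    (f : (ℤ → S) → (ℤ → S)) : Prop :=
  Continuous f ∧ ∀ x, f (shiftZ x) = shiftZ (f x)

/-- Topological transitivity. -/
def IsTransitiveMap {S : Type*} [TopologicalSpace S]
    (f : (ℤ → S) → (ℤ → S)) : Prop :=
  ∀ U V : Set (ℤ → S), IsOpen U → IsOpen V → U.Nonempty → V.Nonempty →
    ∃ n : ℕ, (U ∩ f^[n] '' V).Nonempty

open Classical in
/-- The standard metric on configuration spaces. -/
noncomputable def caDist {S : Type*} (x y : ℤ → S) : ℝ :=
  if x = y then 0
  else (2 : ℝ) ^ (-((sInf {n : ℕ | ∃ i : ℤ, i.natAbs = n ∧ x i ≠ y i} : ℕ) : ℤ))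

/-- Sensitivity to initial conditions with respect to `caDist`. -/
def IsSensitiveMap {S : Type*} (f : (ℤ → S) → (ℤ → S)) : Prop :=
  ∃ ε : ℝ, 0 < ε ∧ ∀ x : ℤ → S, ∀ δ : ℝ, 0 < δ →
    ∃ (y : ℤ → S) (n : ℕ), caDist x y < δ ∧ ε ≤ caDist (f^[n] x) (f^[n] y)

/-- Density of periodic points. -/
def HasDensePeriodicPoints {S : Type*} [TopologicalSpace S]
    (f : (ℤ → S) → (ℤ → S)) : Prop :=
  Dense {x : ℤ → S | ∃ n : ℕ, 0 < n ∧ f^[n] x = x}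

/-- Devaney chaos: sensitive, transitive, dense periodic points. -/
def DevaneyChaotic {S : Type*} [TopologicalSpace S]
    (f : (ℤ → S) → (ℤ → S)) : Prop :=
  IsSensitiveMap f ∧ IsTransitiveMap f ∧ HasDensePeriodicPoints f


theorem caDist_lt_of_agree {S : Type*} {x y : ℤ → S} {m : ℕ}
    (h : ∀ i : ℤ, i.natAbs ≤ m → x i = y i) : caDist x y < (2 : ℝ) ^ (-(m : ℤ)) := by
  unfold caDist
  split_ifs with hxy
  · positivity
  · obtain ⟨j, hj⟩ := Function.ne_iff.mp hxy
    obtain ⟨i, hi, hne⟩ := Nat.sInf_mem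
      (s := {n : ℕ | ∃ i : ℤ, i.natAbs = n ∧ x i ≠ y i}) ⟨_, j, rfl, hj⟩
    rw [← hi]
    apply zpow_lt_zpow_right₀ one_lt_two
    have : ¬ i.natAbs ≤ m := fun hle => hne (h i hle)
    omega

theorem agree_of_caDist_lt {S : Type*} {x y : ℤ → S} {r : ℕ}
    (h : caDist x y < (2 : ℝ) ^ (-(r : ℤ))) (i : ℤ) (hi : i.natAbs ≤ r) : x i = y i := by
  by_contra hne
  have hxy : x ≠ y := fun e => hne (congrFun e i)
  rw [caDist, if_neg hxy, zpow_lt_zpow_iff_right₀ one_lt_two] at h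
  have : sInf {n : ℕ | ∃ i : ℤ, i.natAbs = n ∧ x i ≠ y i} ≤ i.natAbs :=
    Nat.sInf_le ⟨i, rfl, hne⟩
  omega

/-- The cylinder of configurations agreeing with `x` on a finite window is open. -/
theorem isOpen_agree {ι S : Type*} [TopologicalSpace S] [DiscreteTopology S]
    (I : Finset ι) (x : ι → S) : IsOpen {y : ι → S | ∀ i ∈ I, y i = x i} :=
  isOpen_set_pi (s := fun i => {x i}) I.finite_toSet fun _ _ => isOpen_discrete _

/-- A continuous map from a product of finite discrete spaces to a discrete space depends on
finitely many coordinates. -/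
theorem Continuous.exists_finset_agree {ι S T : Type*} [Finite S] [TopologicalSpace S]
    [DiscreteTopology S] [TopologicalSpace T] [DiscreteTopology T] {g : (ι → S) → T}
    (hg : Continuous g) :
    ∃ I : Finset ι, ∀ x y : ι → S, (∀ i ∈ I, x i = y i) → g x = g y := by
  classical
  have key : ∀ x : ι → S, ∃ I : Finset ι, ∀ y, (∀ i ∈ I, y i = x i) → g y = g x := by
    intro x
    have hx : g ⁻¹' {g x} ∈ nhds x := ((isOpen_discrete _).preimage hg).mem_nhds rfl
    rw [nhds_pi, Filter.mem_pi'] at hx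
    obtain ⟨I, t, ht, hsub⟩ := hx
    exact ⟨I, fun y hy => hsub fun i hi => by
      rw [hy i hi]
      exact mem_of_mem_nhds (ht i)⟩
  choose I hI using key
  obtain ⟨t, -, ht⟩ := isCompact_univ.elim_nhds_subcover
    (fun x : ι → S => {y | ∀ i ∈ I x, y i = x i})
    fun x _ => (isOpen_agree (I x) x).mem_nhds fun _ _ => rfl
  refine ⟨t.biUnion I, fun x y hxy => ?_⟩
  obtain ⟨z, hz, hxz⟩ := Set.mem_iUnion₂.mp (ht (Set.mem_univ x))
  rw [hI z x hxz, hI z y fun i hi => ?_]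
  rw [← hxy i (Finset.mem_biUnion.mpr ⟨z, hz, hi⟩), hxz i hi]

theorem IsCellularAutomaton.apply_translate {S : Type*} [TopologicalSpace S]
    {f : (ℤ → S) → (ℤ → S)} (hf : IsCellularAutomaton f) (k : ℤ) (x : ℤ → S) :
    f (fun n => x (n + k)) = fun n => f x (n + k) := by
  induction k using Int.induction_on generalizing x with
  | zero => simp
  | succ k ih =>
    have h := hf.2 (fun n => x (n + k))
    rw [ih] at h
    convert h using 1
    · congr 1
      funext n
      simp only [shiftZ]
      congr 1
      ring
    · funext n
      simp only [shiftZ]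
      congr 1
      ring
  | pred k ih =>
    have h := hf.2 (fun n => x (n + (-k - 1)))
    have e : shiftZ (fun n => x (n + (-(k : ℤ) - 1))) = fun n => x (n + -(k : ℤ)) := by
      funext n
      simp only [shiftZ]
      congr 1
      ring
    rw [e, ih] at h
    funext n
    have hn := congrFun h (n - 1)
    simp only [shiftZ, sub_add_cancel] at hn
    rw [← hn]
    congr 1
    ring

theorem IsCellularAutomaton.iterate_translate {S : Type*} [TopologicalSpace S]
    {f : (ℤ → S) → (ℤ → S)} (hf : IsCellularAutomaton f) (k : ℤ) (n : ℕ) (x : ℤ → S) :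
    f^[n] (fun j => x (j + k)) = fun j => f^[n] x (j + k) := by
  induction n with
  | zero => rfl
  | succ n ih => rw [Function.iterate_succ_apply', ih, hf.apply_translate,
      Function.iterate_succ_apply']

/-- Every cellular automaton on a finite alphabet has a finite radius. -/
theorem IsCellularAutomaton.exists_radius {S : Type*} [Finite S] [TopologicalSpace S]
    [DiscreteTopology S] {f : (ℤ → S) → (ℤ → S)} (hf : IsCellularAutomaton f) :
    ∃ r : ℕ, ∀ (x y : ℤ → S) (k : ℤ),
      (∀ i, k - r ≤ i → i ≤ k + r → x i = y i) → f x k = f y k := by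
  obtain ⟨I, hI⟩ := ((continuous_apply (0 : ℤ)).comp hf.1).exists_finset_agree
  refine ⟨I.sup Int.natAbs, fun x y k h => ?_⟩
  have := hI (fun n => x (n + k)) (fun n => y (n + k)) fun i hi => by
    have := Finset.le_sup (f := Int.natAbs) hi
    exact h _ (by omega) (by omega)
  simpa [hf.apply_translate] using this

/-- Every topologically transitive cellular automaton on a finite alphabet with at
least two letters is sensitive to initial conditions. -/
theorem stmt_2 {S : Type*} [Fintype S] [TopologicalSpace S] [DiscreteTopology S]
    (hS : 1 < Fintype.card S) (f : (ℤ → S) → (ℤ → S))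
    (hca : IsCellularAutomaton f) (htrans : IsTransitiveMap f) :
    ∃ ε : ℝ, 0 < ε ∧ ∀ x : ℤ → S, ∀ δ : ℝ, 0 < δ →
      ∃ (y : ℤ → S) (n : ℕ), caDist x y < δ ∧ ε ≤ caDist (f^[n] x) (f^[n] y) := by
  obtain ⟨r, hr⟩ := hca.exists_radius
  refine ⟨(2 : ℝ) ^ (-(r : ℤ)), by positivity, ?_⟩
  by_contra! hcon
  obtain ⟨x, δ, hδ, hx⟩ := hcon
  obtain ⟨m₀, hm₀⟩ := exists_pow_lt_of_lt_one hδ (one_half_lt_one (α := ℝ))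
  obtain ⟨m, hm, hrm⟩ : ∃ m, m₀ ≤ m ∧ r ≤ m := ⟨max m₀ r, le_max_left _ _, le_max_right _ _⟩
  have hmδ : (2 : ℝ) ^ (-(m : ℤ)) < δ := by
    refine lt_of_le_of_lt ?_ hm₀
    rw [zpow_neg, zpow_natCast, ← inv_pow, ← one_div]
    exact pow_le_pow_of_le_one (by norm_num) (by norm_num) hm
  -- Near `x` the central columns of the space-time diagram are frozen.
  have block : ∀ y : ℤ → S, (∀ i : ℤ, i.natAbs ≤ m → x i = y i) →
      ∀ (n : ℕ) (i : ℤ), i.natAbs ≤ r → f^[n] x i = f^[n] y i := fun y hy n =>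
    agree_of_caDist_lt (hx y n ((caDist_lt_of_agree hy).trans hmδ))
  set p : ℤ := 2 * m + 1 with hp
  -- The `p`-periodic configuration carrying the central word of `x`.
  let y : ℤ → S := fun i => x ((i + m) % p - m)
  have yx : ∀ i : ℤ, i.natAbs ≤ m → x i = y i := fun i hi => by
    simp only [y]
    rw [Int.emod_eq_of_lt (by omega) (by omega), add_sub_cancel_right]
  have yper : (fun j => y (j + p)) = y := by
    funext j
    simp only [y]
    rw [show j + p + m = j + m + p by ring, Int.add_emod_right]
  have yper' : ∀ (n : ℕ) (j : ℤ), f^[n] y (j + p) = f^[n] y j := fun n j => by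
    have := hca.iterate_translate p n y
    rw [yper] at this
    exact (congrFun this j).symm
  have agree : ∀ z : ℤ → S, (∀ i ∈ Finset.Icc (-m : ℤ) (p + m), z i = y i) →
      ∀ (n : ℕ) (i : ℤ), -r ≤ i → i ≤ p + r → f^[n] z i = f^[n] y i := by
    intro z hz n
    induction n with
    | zero => exact fun i h₁ h₂ => hz i (Finset.mem_Icc.mpr ⟨by omega, by omega⟩)
    | succ n ih =>
      intro i h₁ h₂
      by_cases hl : i.natAbs ≤ r
      · rw [← block y yx _ i hl, ← block z (fun j hj => ?_) _ i hl]
        rw [yx j hj, hz j (Finset.mem_Icc.mpr ⟨by omega, by omega⟩)]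
      by_cases hR : (i - p).natAbs ≤ r
      · have hzp := block (fun j => z (j + p)) (fun j hj => by
          rw [yx j hj, hz _ (Finset.mem_Icc.mpr ⟨by omega, by omega⟩)]
          exact (congrFun yper j).symm) (n + 1) (i - p) hR
        simp only [hca.iterate_translate, sub_add_cancel] at hzp
        rw [← hzp, block y yx _ _ hR, ← yper', sub_add_cancel]
      · rw [Function.iterate_succ_apply', Function.iterate_succ_apply']
        exact hr _ _ _ fun j h₃ h₄ => ih j (by omega) (by omega)
  obtain ⟨a, b, hab⟩ := Fintype.one_lt_card_iff.mp hS
  have hU : IsOpen {z : ℤ → S | z 0 ≠ z p} :=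
    (isClosed_eq (continuous_apply 0) (continuous_apply p)).isOpen_compl
  obtain ⟨n, w, hw, z, hz, rfl⟩ := htrans _ _ hU (isOpen_agree (Finset.Icc (-m : ℤ) (p + m)) y)
    ⟨fun i => if i = 0 then a else b, by simp [show p ≠ 0 by omega, hab]⟩ ⟨y, fun _ _ => rfl⟩
  refine hw ?_
  rw [agree z hz n 0 (by omega) (by omega), agree z hz n p (by omega) (by omega), ← yper' n 0,
    zero_add]
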